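/- (Henning–Yeo) For every even integer t ≥ 4, every connected graph G with n vertices, m edges, and maximum degree at most t contains a matching of size at least n/(t(t+1)) + m/(t+1) − 1/t. -/

import Mathlib

open SimpleGraph

/-- Delete all edges meeting `S`. -/
def hyDel {V : Type*} (G : SimpleGraph V) (S : Set V) : SimpleGraph V where
  Adj u v := G.Adj u v ∧ u ∉ S ∧ v ∉ S
  symm := ⟨fun _ _ h => ⟨h.1.symm, h.2.2, h.2.1⟩⟩
  loopless := ⟨fun _ h => h.1.ne rfl⟩

lemma hy_num1 (t k n D : ℕ) (ht : 4 ≤ t) (h1 : D ≤ t * n) (h2 : D ≤ n * (n - 1))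
    (hte : Even t) (hk : n = 2 * k ∨ n = 2 * k + 1) :
    2 * n + t * D ≤ 2 * t * (t + 1) * k + 2 * (t + 1) := by
  obtain ⟨a, rfl⟩ := hte
  rcases hk with rfl | rfl
  · nlinarith [Nat.zero_le (k * (a + a))]
  · by_cases h : 2 * k + 1 ≤ a + a
    · have h3 : D ≤ (2 * k) * (a + a) := by
        refine h2.trans ?_
        simp only [Nat.add_sub_cancel]
        nlinarith
      nlinarith [Nat.mul_le_mul_left (a + a) h3, Nat.zero_le (k * (a + a))]
    · have hak : a ≤ k := by omega
      obtain ⟨b, rfl⟩ := Nat.exists_eq_add_of_le hak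
      nlinarith [Nat.mul_le_mul_left (a + a) h1, Nat.zero_le (b * a), Nat.mul_le_mul_left b ht]

lemma hy_num2 (t k n D : ℕ) (ht : 4 ≤ t) (h1 : D < t * n) (h2 : D ≤ n * (n - 1))
    (hte : Even t) (hD : Even D) (hk : n = 2 * k + 1) :
    2 * n + t * D ≤ 2 * t * (t + 1) * k + 2 := by
  obtain ⟨a, rfl⟩ := hte
  obtain ⟨e, rfl⟩ := hD
  subst hk
  by_cases h : 2 * k + 1 ≤ a + a
  · have h2k : 2 * k + 2 ≤ a + a := by omega
    have h3 : e + e ≤ (2 * k) * (a + a - 1) := by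
      refine h2.trans ?_
      simp only [Nat.add_sub_cancel]
      rw [mul_comm]
      exact Nat.mul_le_mul_left _ (by omega)
    obtain ⟨c, hc⟩ : ∃ c, a + a = c + 1 := ⟨a + a - 1, by omega⟩
    rw [hc] at h3 ⊢
    rw [Nat.add_sub_cancel] at h3
    nlinarith [Nat.mul_le_mul_left (c + 1) h3, Nat.zero_le (k * c)]
  · have hak : a ≤ k := by omega
    have h1' : e + e + 2 ≤ (a + a) * (2 * k + 1) := by
      have : (a + a) * (2 * k + 1) = 2 * (a * (2 * k + 1)) := by ring
      omega
    obtain ⟨b, rfl⟩ := Nat.exists_eq_add_of_le hak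
    nlinarith [Nat.mul_le_mul_left (a + a) h1', Nat.zero_le (b * a), Nat.mul_le_mul_left b ht]

lemma hy_num3 (t k n D : ℕ) (ht : 4 ≤ t) (h1 : D ≤ t * n) (hk : n = 2 * k) :
    2 * n + t * D ≤ 2 * t * (t + 1) * k := by
  subst hk
  nlinarith [Nat.mul_le_mul_left t h1, Nat.mul_le_mul_left k ht]

open Classical in
lemma hy_match_card {V : Type*} [Fintype V] {G : SimpleGraph V} (M : G.Subgraph)
    (hM : M.IsMatching) : M.verts.ncard = 2 * M.edgeSet.ncard := by
  have h := M.spanningCoe.sum_degrees_eq_twice_card_edges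
  have h2 : M.edgeSet.ncard = M.spanningCoe.edgeFinset.card := by
    rw [← Subgraph.edgeSet_spanningCoe, Set.ncard_eq_toFinset_card']
    rfl
  rw [h2, ← h, Set.ncard_eq_toFinset_card']
  rw [Finset.card_eq_sum_ones, ← Finset.sum_subset (Finset.subset_univ M.verts.toFinset)]
  · refine Finset.sum_congr rfl fun v hv => ?_
    obtain ⟨w, hw, hu⟩ := hM (Set.mem_toFinset.1 hv)
    symm
    rw [← card_neighborFinset_eq_degree, Finset.card_eq_one]
    refine ⟨w, ?_⟩
    ext x
    simp only [mem_neighborFinset, Subgraph.spanningCoe_adj, Finset.mem_singleton]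
    exact ⟨fun h => hu x h, fun h => h ▸ hw⟩
  · intro v _ hv
    rw [← card_neighborFinset_eq_degree, Finset.card_eq_zero]
    ext x
    simp only [mem_neighborFinset, Subgraph.spanningCoe_adj, Finset.notMem_empty, iff_false]
    exact fun h => hv (Set.mem_toFinset.2 (M.edge_vert h))

/-- closed embedding: supports -/
lemma hy_supp {V W : Type*} {K : SimpleGraph W} {H : SimpleGraph V} (φ : W → V)
    (hadj : ∀ x y, H.Adj (φ x) (φ y) ↔ K.Adj x y)
    (hcl : ∀ x v, H.Adj (φ x) v → v ∈ Set.range φ) (hinj : Function.Injective φ) (x : W) :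
    (H.connectedComponentMk (φ x)).supp = φ '' (K.connectedComponentMk x).supp := by
  ext v
  simp only [ConnectedComponent.mem_supp_iff, ConnectedComponent.eq, Set.mem_image]
  constructor
  · intro h
    replace h := h.symm
    rw [SimpleGraph.reachable_iff_reflTransGen] at h
    induction h with
    | refl => exact ⟨x, Reachable.refl _, rfl⟩
    | tail _ hbc ih =>
      obtain ⟨y, hy, rfl⟩ := ih
      obtain ⟨z, rfl⟩ := hcl _ _ hbc
      exact ⟨z, (((hadj y z).1 hbc).symm.reachable).trans hy, rfl⟩
  · rintro ⟨y, hy, rfl⟩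
    exact hy.map ⟨φ, fun {a b} h => (hadj a b).2 h⟩

lemma hy_odd {V W : Type*} [Finite V] {K : SimpleGraph W} {H : SimpleGraph V} (φ : W → V)
    (hadj : ∀ x y, H.Adj (φ x) (φ y) ↔ K.Adj x y)
    (hcl : ∀ x v, H.Adj (φ x) v → v ∈ Set.range φ) (hinj : Function.Injective φ)
    (S : Set V) (hS : ∀ x, φ x ∉ S) (hiso : ∀ s ∈ S, ∀ v, ¬ H.Adj s v) :
    S.ncard + K.oddComponents.ncard ≤ H.oddComponents.ncard := by
  let Φ : K.ConnectedComponent → H.ConnectedComponent :=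
    ConnectedComponent.map ⟨φ, fun {a b} h => (hadj a b).2 h⟩
  have hΦ : ∀ x, Φ (K.connectedComponentMk x) = H.connectedComponentMk (φ x) := fun x => rfl
  have hfin : Finite W := Finite.of_injective φ hinj
  have hsing : ∀ s ∈ S, (H.connectedComponentMk s).supp = {s} := by
    intro s hs
    ext v
    simp only [ConnectedComponent.mem_supp_iff, ConnectedComponent.eq, Set.mem_singleton_iff]
    constructor
    · intro h
      replace h := h.symm
      rw [SimpleGraph.reachable_iff_reflTransGen] at h
      rcases Relation.ReflTransGen.cases_head h with h | ⟨c, hc, _⟩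
      · exact h.symm
      · exact absurd hc (hiso s hs c)
    · rintro rfl; exact Reachable.refl _
  have hΦinj : Function.Injective Φ := by
    intro c d
    induction c using ConnectedComponent.ind
    induction d using ConnectedComponent.ind
    rename_i x y
    intro h
    rw [hΦ, hΦ] at h
    have : φ x ∈ (H.connectedComponentMk (φ y)).supp := h
    rw [hy_supp φ hadj hcl hinj] at this
    obtain ⟨z, hz, hzx⟩ := this
    rw [hinj hzx] at hz
    exact hz
  have hsinj : Set.InjOn H.connectedComponentMk S := by
    intro a ha b hb h
    have := hsing a ha
    rw [h, hsing b hb] at this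
    exact (Set.singleton_injective this).symm
  rw [← Set.InjOn.ncard_image hsinj, ← Set.ncard_image_of_injective K.oddComponents hΦinj,
    ← Set.ncard_union_eq]
  · refine Set.ncard_le_ncard ?_ (Set.toFinite _)
    rintro c (⟨s, hs, rfl⟩ | ⟨d, hd, rfl⟩)
    · show Odd _
      rw [hsing s hs]; simp
    · induction d using ConnectedComponent.ind
      show Odd _
      rw [hΦ, hy_supp φ hadj hcl hinj, Set.ncard_image_of_injective _ hinj]
      exact hd
  · rw [Set.disjoint_left]
    rintro c ⟨s, hs, rfl⟩ ⟨d, hd, hh⟩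
    induction d using ConnectedComponent.ind
    rename_i x
    rw [hΦ] at hh
    have : φ x ∈ (H.connectedComponentMk s).supp := hh
    rw [hsing s hs] at this
    exact hS x (this ▸ hs)

/-- `G` joined with a clique on `d` vertices. -/
def hyJoin {V : Type*} (G : SimpleGraph V) (d : ℕ) : SimpleGraph (V ⊕ Fin d) where
  Adj x y := x ≠ y ∧ ∀ u v, x = Sum.inl u → y = Sum.inl v → G.Adj u v
  symm := ⟨fun _ _ h => ⟨h.1.symm, fun u v hu hv => (h.2 v u hv hu).symm⟩⟩
  loopless := ⟨fun _ h => h.1 rfl⟩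

lemma hyJoin_inl {V : Type*} (G : SimpleGraph V) (d : ℕ) (u v : V) :
    (hyJoin G d).Adj (Sum.inl u) (Sum.inl v) ↔ G.Adj u v := by
  constructor
  · intro h; exact h.2 u v rfl rfl
  · intro h
    refine ⟨fun e => h.ne (Sum.inl_injective e), fun a b ha hb => ?_⟩
    cases ha; cases hb; exact h

lemma hy_restrict {V : Type*} [Fintype V] (G : SimpleGraph V) (d : ℕ)
    (M' : (hyJoin G d).Subgraph) (hM' : M'.IsPerfectMatching) :
    ∃ M : G.Subgraph, M.IsMatching ∧ Fintype.card V ≤ 2 * M.edgeSet.ncard + d := by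
  classical
  rw [Subgraph.isPerfectMatching_iff] at hM'
  let M : G.Subgraph :=
    { verts := {v | ∃ w, M'.Adj (Sum.inl v) (Sum.inl w)}
      Adj := fun v w => M'.Adj (Sum.inl v) (Sum.inl w)
      adj_sub := fun {v w} h => (hyJoin_inl G d v w).1 (M'.adj_sub h)
      edge_vert := fun {v w} h => ⟨w, h⟩
      symm := ⟨fun v w h => M'.adj_symm h⟩ }
  have hM : M.IsMatching := by
    rintro v ⟨w, hw⟩
    refine ⟨w, hw, fun y hy => ?_⟩
    exact Sum.inl_injective ((hM' (Sum.inl v)).unique hy hw)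
  refine ⟨M, hM, ?_⟩
  rw [← hy_match_card M hM]
  have hc : (M.vertsᶜ).ncard ≤ d := by
    choose p hp huniq using hM'
    have : ∀ v ∈ M.vertsᶜ, ∃ i : Fin d, p (Sum.inl v) = Sum.inr i := by
      intro v hv
      rcases h : p (Sum.inl v) with w | i
      · exact absurd ⟨w, h ▸ hp (Sum.inl v)⟩ hv
      · exact ⟨i, rfl⟩
    have hq' : Set.InjOn (fun v => p (Sum.inl v)) M.vertsᶜ := by
      intro a _ b _ hab
      simp only at hab
      have h1 := (hp (Sum.inl a)).symm
      have h2 := (hp (Sum.inl b)).symm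
      rw [← hab] at h2
      exact Sum.inl_injective ((huniq _ _ h1).trans (huniq _ _ h2).symm)
    calc _ = ((fun v => p (Sum.inl v)) '' M.vertsᶜ).ncard := (Set.InjOn.ncard_image hq').symm
      _ ≤ (Set.range (Sum.inr : Fin d → V ⊕ Fin d)).ncard := by
        refine Set.ncard_le_ncard ?_ (Set.toFinite _)
        rintro _ ⟨v, hv, rfl⟩
        obtain ⟨i, hi⟩ := this v hv
        exact ⟨i, hi.symm⟩
      _ = d := by
        rw [← Set.image_univ, Set.ncard_image_of_injective _ Sum.inr_injective]
        simp [Set.ncard_univ]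
  have := Set.ncard_add_ncard_compl M.verts
  rw [Nat.card_eq_fintype_card] at this
  omega

lemma hy_tb {V : Type*} [Fintype V] (G : SimpleGraph V) :
    ∃ M : G.Subgraph, M.IsMatching ∧ ∃ S : Set V,
      Fintype.card V + 2 * S.ncard ≤ 2 * M.edgeSet.ncard + (hyDel G S).oddComponents.ncard := by
  classical
  obtain ⟨M, hM, hmax⟩ := Set.exists_max_image {M : G.Subgraph | M.IsMatching}
    (fun M => M.edgeSet.ncard) (Set.toFinite _) ⟨⊥, by intro v hv; exact hv.elim⟩
  refine ⟨M, hM, ?_⟩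
  by_cases hsm : Fintype.card V ≤ 2 * M.edgeSet.ncard + 1
  · refine ⟨∅, ?_⟩
    have := (hyDel G ∅).odd_ncard_oddComponents
    rw [Nat.card_eq_fintype_card] at this
    rw [Set.ncard_empty]
    by_cases ho : Odd (Fintype.card V)
    · have := (this.2 ho).pos
      omega
    · rw [Nat.not_odd_iff_even] at ho
      obtain ⟨r, hr⟩ := ho
      omega
  obtain ⟨d, hd⟩ : ∃ d, Fintype.card V = 2 * M.edgeSet.ncard + 2 + d :=
    ⟨_, (Nat.add_sub_of_le (by omega)).symm⟩
  have hno : ∀ M' : (hyJoin G d).Subgraph, ¬ M'.IsPerfectMatching := by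
    intro M' hM'
    obtain ⟨N, hN, hN'⟩ := hy_restrict G d M' hM'
    have := hmax N hN
    omega
  have hcard : Nat.card (V ⊕ Fin d) = Fintype.card V + d := by simp
  obtain ⟨U, hU⟩ := exists_isTutteViolator hno (by rw [hcard]; exact ⟨M.edgeSet.ncard + 1 + d, by omega⟩)
  unfold IsTutteViolator at hU
  set K := ((⊤ : (hyJoin G d).Subgraph).deleteVerts U).coe with hK
  have hKadj : ∀ x y, K.Adj x y ↔ (hyJoin G d).Adj x.1 y.1 := by
    intro x y
    have hx := x.2
    have hy := y.2
    simp only [Subgraph.deleteVerts_verts] at hx hy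
    simp [hK, hx.2, hy.2]
  have hKv : ∀ x : ((⊤ : (hyJoin G d).Subgraph).deleteVerts U).verts, x.1 ∉ U := by
    intro x
    have hx := x.2
    simp only [Subgraph.deleteVerts_verts] at hx
    exact hx.2
  have hU2 : U.ncard + 2 ≤ K.oddComponents.ncard := by
    have hp := K.odd_ncard_oddComponents
    have h1 : Nat.card ((⊤ : (hyJoin G d).Subgraph).deleteVerts U).verts + U.ncard
        = Fintype.card V + d := by
      rw [← hcard, ← Set.ncard_add_ncard_compl U, add_comm, Nat.card_coe_set_eq]
      congr 2
      ext x; simp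
    by_contra hlt
    have : K.oddComponents.ncard = U.ncard + 1 := by omega
    rw [this] at hp
    simp only [Nat.odd_iff] at hp
    omega
  have hUr : ∀ i : Fin d, Sum.inr i ∈ U := by
    intro i
    by_contra hi
    have hss : Subsingleton K.ConnectedComponent := by
      let z : ((⊤ : (hyJoin G d).Subgraph).deleteVerts U).verts := ⟨Sum.inr i, by simpa using hi⟩
      have : ∀ c : K.ConnectedComponent, c = K.connectedComponentMk z := by
        intro c
        induction c using ConnectedComponent.ind
        rename_i x
        by_cases hxz : x = z
        · rw [hxz]
        · rw [ConnectedComponent.eq]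
          refine Adj.reachable ((hKadj _ _).2 ⟨fun h => hxz (Subtype.ext h), ?_⟩)
          intro u v _ h
          cases h
      exact ⟨fun a b => (this a).trans (this b).symm⟩
    have := Set.ncard_le_one_of_subsingleton K.oddComponents
    omega
  let S : Set V := Sum.inl ⁻¹' U
  refine ⟨S, ?_⟩
  have hUc : U.ncard = S.ncard + d := by
    have : U = Sum.inl '' S ∪ Set.range (Sum.inr : Fin d → V ⊕ Fin d) := by
      ext x
      rcases x with v | i
      · simp [S]
      · simp [hUr i]
    rw [this, Set.ncard_union_eq, Set.ncard_image_of_injective _ Sum.inl_injective,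
      ← Set.image_univ, Set.ncard_image_of_injective _ Sum.inr_injective]
    · simp [Set.ncard_univ]
    · rw [Set.disjoint_left]
      rintro x ⟨v, _, rfl⟩ ⟨i, hi⟩
      cases hi
  have hne : ∀ x : ((⊤ : (hyJoin G d).Subgraph).deleteVerts U).verts, ∃ v : V, x.1 = Sum.inl v := by
    rintro ⟨x, hx⟩
    rcases x with v | i
    · exact ⟨v, rfl⟩
    · exact absurd (hUr i) (hKv ⟨_, hx⟩)
  choose φ hφ using hne
  have hφS : ∀ x, φ x ∉ S := by
    intro x hx
    apply hKv x
    rw [hφ]; exact hx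
  have := hy_odd (K := K) (H := hyDel G S) φ ?_ ?_ ?_ S hφS ?_
  · omega
  · intro x y
    rw [hKadj, hφ x, hφ y, hyJoin_inl]
    exact ⟨fun h => h.1, fun h => ⟨h, hφS x, hφS y⟩⟩
  · intro x v h
    refine ⟨⟨Sum.inl v, ?_⟩, ?_⟩
    · have := h.2.2
      simpa [S] using this
    · apply Sum.inl_injective (β := Fin d)
      rw [← hφ]
  · intro x y h
    apply Subtype.ext
    rw [hφ, hφ, h]
  · intro s hs v h
    exact h.2.1 hs

open Classical in
/-- Edges of `G` meeting `S`. -/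
lemma hy_incident {V : Type*} [Fintype V] (G : SimpleGraph V) (S : Set V) (t : ℕ)
    (hdeg : ∀ v, (G.neighborSet v).ncard ≤ t) :
    (G.edgeSet \ (hyDel G S).edgeSet).ncard ≤ t * S.ncard := by
  have hsub : G.edgeSet \ (hyDel G S).edgeSet ⊆
      ((S.toFinset.biUnion fun s => G.incidenceFinset s : Finset (Sym2 V)) : Set (Sym2 V)) := by
    rintro e ⟨he, hn⟩
    induction e using Sym2.ind
    rename_i u v
    simp only [mem_edgeSet] at he hn
    simp only [Finset.coe_biUnion, Set.mem_iUnion, Finset.mem_coe, mem_incidenceFinset,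
      Set.mem_toFinset]
    by_cases hu : u ∈ S
    · exact ⟨u, hu, he, Sym2.mem_mk_left _ _⟩
    · have hv : v ∈ S := by
        by_contra hv
        exact hn ⟨he, hu, hv⟩
      exact ⟨v, hv, he, Sym2.mem_mk_right _ _⟩
  refine (Set.ncard_le_ncard hsub (Set.toFinite _)).trans ?_
  rw [Set.ncard_coe_finset, Set.ncard_eq_toFinset_card', mul_comm]
  refine Finset.card_biUnion_le_card_mul _ _ _ fun s _ => ?_
  rw [card_incidenceFinset_eq_degree]
  have := hdeg s
  rwa [Set.ncard_eq_toFinset_card'] at this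

lemma hy_comps {V : Type*} [Fintype V] (G H : SimpleGraph V) (hconn : G.Connected) :
    Nat.card H.ConnectedComponent ≤ (G.edgeSet \ H.edgeSet).ncard + 1 := by
  classical
  let π : V → H.ConnectedComponent := H.connectedComponentMk
  let Q : SimpleGraph H.ConnectedComponent :=
    { Adj := fun c d => c ≠ d ∧ ∃ u v, G.Adj u v ∧ π u = c ∧ π v = d
      symm := ⟨fun c d ⟨h, u, v, a, b, e⟩ => ⟨h.symm, v, u, a.symm, e, b⟩⟩
      loopless := ⟨fun c h => h.1 rfl⟩ }
  have hreach : ∀ u v, G.Reachable u v → Q.Reachable (π u) (π v) := by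
    intro u v h
    rw [SimpleGraph.reachable_iff_reflTransGen] at h
    induction h with
    | refl => exact Reachable.refl _
    | @tail b c _ hbc ih =>
      by_cases hh : π b = π c
      · rw [← hh]; exact ih
      · exact ih.trans (Adj.reachable ⟨hh, b, c, hbc, rfl, rfl⟩)
  have hQ : Q.Connected := by
    have := hconn.nonempty
    have hne : Nonempty H.ConnectedComponent := this.map π
    refine { preconnected := fun c d => ?_, nonempty := hne }
    induction c using ConnectedComponent.ind
    induction d using ConnectedComponent.ind
    exact hreach _ _ (hconn.preconnected _ _)
  refine hQ.card_vert_le_card_edgeSet_add_one.trans ?_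
  have hsub : Q.edgeSet ⊆ Sym2.map π '' (G.edgeSet \ H.edgeSet) := by
    intro e he
    induction e using Sym2.ind
    obtain ⟨hne, u, v, huv, rfl, rfl⟩ := he
    refine ⟨s(u, v), ⟨huv, fun h => hne ?_⟩, rfl⟩
    exact ConnectedComponent.sound (Adj.reachable h)
  have h1 := Set.ncard_le_ncard hsub (Set.toFinite _)
  have h2 := Set.ncard_image_le (f := Sym2.map π) (Set.toFinite (G.edgeSet \ H.edgeSet))
  rw [Nat.card_coe_set_eq]
  omega

open Classical in
lemma hy_even {V : Type*} [Fintype V] (H : SimpleGraph V) (c : H.ConnectedComponent) :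
    Even (∑ v ∈ c.supp.toFinset, H.degree v) := by
  let Hc : SimpleGraph V :=
    { Adj := fun u v => H.Adj u v ∧ u ∈ c.supp ∧ v ∈ c.supp
      symm := ⟨fun _ _ h => ⟨h.1.symm, h.2.2, h.2.1⟩⟩
      loopless := ⟨fun _ h => h.1.ne rfl⟩ }
  have h := Hc.sum_degrees_eq_twice_card_edges
  have h2 : ∑ v ∈ c.supp.toFinset, H.degree v = ∑ v, Hc.degree v := by
    rw [← Finset.sum_subset (Finset.subset_univ c.supp.toFinset)]
    · refine Finset.sum_congr rfl fun v hv => ?_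
      rw [Set.mem_toFinset] at hv
      rw [← card_neighborFinset_eq_degree, ← card_neighborFinset_eq_degree]
      congr 1
      ext w
      simp only [mem_neighborFinset]
      refine ⟨fun h => ⟨h, hv, ?_⟩, fun h => h.1⟩
      rw [ConnectedComponent.mem_supp_iff] at hv ⊢
      rw [← hv]
      exact ConnectedComponent.sound h.symm.reachable
    · intro v _ hv
      rw [Set.mem_toFinset] at hv
      rw [← card_neighborFinset_eq_degree, Finset.card_eq_zero]
      ext w
      simp only [mem_neighborFinset, Finset.notMem_empty, iff_false]
      exact fun h => hv h.2.1
  rw [h2, h]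
  exact even_two_mul _

open Classical in
lemma hy_compbound {V : Type*} [Fintype V] (H : SimpleGraph V) (c : H.ConnectedComponent) :
    ∑ v ∈ c.supp.toFinset, H.degree v ≤ c.supp.ncard * (c.supp.ncard - 1) := by
  rw [Set.ncard_eq_toFinset_card', ← smul_eq_mul]
  refine Finset.sum_le_card_nsmul _ _ _ fun v hv => ?_
  rw [← Finset.card_erase_of_mem hv, ← card_neighborFinset_eq_degree]
  refine Finset.card_le_card fun w hw => ?_
  rw [mem_neighborFinset] at hw
  rw [Set.mem_toFinset] at hv
  rw [Finset.mem_erase, Set.mem_toFinset]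
  refine ⟨hw.ne', ?_⟩
  rw [ConnectedComponent.mem_supp_iff] at hv ⊢
  rw [← hv]
  exact ConnectedComponent.sound hw.symm.reachable

open Classical in
lemma hy_strict {V : Type*} [Fintype V] (G : SimpleGraph V) (hconn : G.Connected) (S : Set V)
    (hS : S.Nonempty) (t : ℕ) (ht : 0 < t) (hdeg : ∀ v, G.degree v ≤ t)
    (c : (hyDel G S).ConnectedComponent) :
    ∑ v ∈ c.supp.toFinset, (hyDel G S).degree v < t * c.supp.ncard := by
  rw [Set.ncard_eq_toFinset_card', mul_comm, ← smul_eq_mul, ← Finset.sum_const]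
  have hle : hyDel G S ≤ G := fun u v h => h.1
  refine Finset.sum_lt_sum (fun v _ => (degree_le_of_le hle).trans (hdeg v)) ?_
  simp only [Set.mem_toFinset]
  obtain ⟨s, hs⟩ := hS
  by_cases hsc : s ∈ c.supp
  · refine ⟨s, hsc, ?_⟩
    refine lt_of_eq_of_lt ?_ ht
    rw [← card_neighborFinset_eq_degree, Finset.card_eq_zero]
    ext w
    simp only [mem_neighborFinset, Finset.notMem_empty, iff_false]
    exact fun h => h.2.1 hs
  · obtain ⟨v, hv⟩ := c.nonempty_supp
    obtain ⟨p⟩ := hconn.preconnected v s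
    obtain ⟨d, _, hd1, hd2⟩ := p.exists_boundary_dart c.supp hv hsc
    refine ⟨d.fst, hd1, lt_of_lt_of_le ?_ (hdeg d.fst)⟩
    rw [← card_neighborFinset_eq_degree, ← card_neighborFinset_eq_degree]
    refine Finset.card_lt_card ⟨?_, ?_⟩
    · intro w hw
      rw [mem_neighborFinset] at hw ⊢
      exact hle hw
    · intro h
      have := h (show d.snd ∈ G.neighborFinset d.fst by rw [mem_neighborFinset]; exact d.adj)
      rw [mem_neighborFinset] at this
      apply hd2
      rw [ConnectedComponent.mem_supp_iff] at hd1 ⊢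
      rw [← hd1]
      exact ConnectedComponent.sound this.symm.reachable

open Classical in
lemma hy_nat {V : Type*} [Fintype V]
    (t : ℕ) (hteven : Even t) (ht : 4 ≤ t)
    (G : SimpleGraph V) (hconn : G.Connected)
    (hdeg : ∀ v : V, (G.neighborSet v).ncard ≤ t) :
    ∃ M : G.Subgraph, M.IsMatching ∧
      Fintype.card V + t * G.edgeSet.ncard ≤ t * (t + 1) * M.edgeSet.ncard + (t + 1) := by
  obtain ⟨M, hM, S, hS⟩ := hy_tb G
  refine ⟨M, hM, ?_⟩
  have hdeg' : ∀ v, G.degree v ≤ t := by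
    intro v
    have := hdeg v
    rwa [Set.ncard_eq_toFinset_card'] at this
  set H := hyDel G S with hH
  have hle : H ≤ G := fun u v h => h.1
  have hR := hy_comps G H hconn
  have hI := hy_incident G S t hdeg
  rw [← hH] at hI
  have hm : G.edgeSet.ncard = (G.edgeSet \ H.edgeSet).ncard + H.edgeSet.ncard :=
    (Set.ncard_sdiff_add_ncard_of_subset (edgeSet_mono hle) (Set.toFinite _)).symm
  have hsum : ∑ v, H.degree v = 2 * H.edgeSet.ncard := by
    rw [sum_degrees_eq_twice_card_edges, Set.ncard_eq_toFinset_card']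
    rfl
  have hfib : ∀ f : V → ℕ, ∑ c : H.ConnectedComponent, ∑ v ∈ c.supp.toFinset, f v = ∑ v, f v := by
    intro f
    rw [← Finset.sum_fiberwise Finset.univ H.connectedComponentMk f]
    refine Finset.sum_congr rfl fun c _ => Finset.sum_congr ?_ fun _ _ => rfl
    ext v
    simp
  have hn : ∑ c : H.ConnectedComponent, c.supp.ncard = Fintype.card V := by
    rw [← Finset.card_univ, Finset.card_eq_sum_ones, ← hfib]
    refine Finset.sum_congr rfl fun c _ => ?_
    rw [Set.ncard_eq_toFinset_card', Finset.card_eq_sum_ones]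
  have hD := hfib (fun v => H.degree v)
  have hodd : H.oddComponents.ncard = ∑ c : H.ConnectedComponent, c.supp.ncard % 2 := by
    rw [Set.ncard_eq_toFinset_card', Finset.card_eq_sum_ones,
      ← Finset.sum_subset (Finset.subset_univ H.oddComponents.toFinset)]
    · refine Finset.sum_congr rfl fun c hc => ?_
      rw [Set.mem_toFinset] at hc
      exact (Nat.odd_iff.1 hc).symm
    · intro c _ hc
      rw [Set.mem_toFinset] at hc
      exact Nat.even_iff.1 (Nat.not_odd_iff_even.1 hc)
  have hoddR : H.oddComponents.ncard ≤ Nat.card H.ConnectedComponent := by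
    rw [← Set.ncard_univ]
    exact Set.ncard_le_ncard (Set.subset_univ _) (Set.toFinite _)
  have hk : Fintype.card V = 2 * ∑ c : H.ConnectedComponent, c.supp.ncard / 2
      + H.oddComponents.ncard := by
    rw [hodd, ← hn, Finset.mul_sum, ← Finset.sum_add_distrib]
    exact Finset.sum_congr rfl fun c _ => (Nat.div_add_mod _ _).symm
  have hDle : ∀ c : H.ConnectedComponent,
      ∑ v ∈ c.supp.toFinset, H.degree v ≤ t * c.supp.ncard := by
    intro c
    rw [Set.ncard_eq_toFinset_card', mul_comm, ← smul_eq_mul]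
    exact Finset.sum_le_card_nsmul _ _ _ fun v _ => (degree_le_of_le hle).trans (hdeg' v)
  rcases S.eq_empty_or_nonempty with hSe | hSn
  · have hs0 : S.ncard = 0 := by rw [hSe]; simp
    have hN : 2 * H.edgeSet.ncard ≤ t * Fintype.card V := by
      rw [← hsum, ← hD, ← hn, Finset.mul_sum]
      exact Finset.sum_le_sum fun c _ => hDle c
    have hN2 : 2 * H.edgeSet.ncard ≤ Fintype.card V * (Fintype.card V - 1) := by
      rw [← hsum, ← smul_eq_mul]
      refine Finset.sum_le_card_nsmul _ _ _ fun v _ => ?_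
      have := H.degree_lt_card_verts v
      omega
    have := hy_num1 t (Fintype.card V / 2) (Fintype.card V) _ ht hN hN2 hteven (by omega)
    have hmm : G.edgeSet.ncard = H.edgeSet.ncard := by
      rw [hs0] at hI; omega
    have hν : Fintype.card V / 2 ≤ M.edgeSet.ncard := by
      rw [hs0] at hI hS
      omega
    rw [hmm]
    nlinarith [Nat.mul_le_mul_left (t * (t + 1)) hν]
  · have hc : ∀ c : H.ConnectedComponent,
        2 * c.supp.ncard + t * ∑ v ∈ c.supp.toFinset, H.degree v ≤
        2 * t * (t + 1) * (c.supp.ncard / 2) + 2 * (c.supp.ncard % 2) := by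
      intro c
      rcases Nat.mod_two_eq_zero_or_one c.supp.ncard with h | h
      · rw [h]
        exact hy_num3 t _ _ _ ht (hDle c) (by omega)
      · rw [h]
        exact hy_num2 t _ _ _ ht (hy_strict G hconn S hSn t (by omega) hdeg' c)
          (hy_compbound H c) hteven (hy_even H c) (by omega)
    have hcs := Finset.sum_le_sum fun c (_ : c ∈ Finset.univ) => hc c
    rw [Finset.sum_add_distrib, Finset.sum_add_distrib, ← Finset.mul_sum, ← Finset.mul_sum,
      ← Finset.mul_sum, ← Finset.mul_sum, ← hodd, hn, hD, hsum] at hcs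
    have hν : ∑ c : H.ConnectedComponent, c.supp.ncard / 2 + S.ncard ≤ M.edgeSet.ncard := by
      omega
    have ho : H.oddComponents.ncard ≤ t * S.ncard + 1 := by omega
    rw [hm]
    nlinarith [Nat.mul_le_mul_left (t * (t + 1)) hν, Nat.mul_le_mul_left t hI]

/-- (Henning–Yeo) For every even `t ≥ 4`, every connected graph `G` with `n` vertices,
`m` edges and maximum degree at most `t` contains a matching of size at least
`n/(t(t+1)) + m/(t+1) - 1/t`. -/
theorem henning_yeo_even {V : Type*} [Fintype V]
    (t : ℕ) (hteven : Even t) (ht : 4 ≤ t)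
    (G : SimpleGraph V) (hconn : G.Connected)
    (hdeg : ∀ v : V, (G.neighborSet v).ncard ≤ t) :
    ∃ M : G.Subgraph, M.IsMatching ∧
      (Fintype.card V : ℝ) / (t * (t + 1)) + (G.edgeSet.ncard : ℝ) / (t + 1) -
        1 / (t : ℝ) ≤ (M.edgeSet.ncard : ℝ) := by
  obtain ⟨M, hM, h⟩ := hy_nat t hteven ht G hconn hdeg
  refine ⟨M, hM, ?_⟩
  have htp : (0 : ℝ) < t := by exact_mod_cast (by omega : 0 < t)
  have h' : (Fintype.card V : ℝ) + t * G.edgeSet.ncard ≤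
      t * (t + 1) * M.edgeSet.ncard + (t + 1) := by exact_mod_cast h
  have he : (Fintype.card V : ℝ) / (t * (t + 1)) + (G.edgeSet.ncard : ℝ) / (t + 1) - 1 / (t : ℝ)
      = ((Fintype.card V : ℝ) + t * G.edgeSet.ncard - (t + 1)) / (t * (t + 1)) := by
    field_simp
  rw [he, div_le_iff₀ (by positivity)]
  linarith
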